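/- arXiv:2210.10714 — 3 statements merged into one kernel-verified Lean document; each statement's English description precedes it below -/
import Mathlib

section
/- (Weak convergence of (IPA).) Let f and g be monotone, upper hemicontinuous equilibrium bifunctions on K such that for each y ∈ K there exists x* ∈ H with g(y,z) ≥ ⟨x*, z − y⟩ for all z ∈ K. Assume S is nonempty and that for every u ∈ S there exists p ∈ N_{S_f}(u) with g(u,y) + ⟨p, y − u⟩ ≥ 0 for all y ∈ K for which the geometric condition (GC) holds for the pair (u,p). Let (xₙ) be a sequence generated by the inertial proximal algorithm (IPA) with 0 ≤ α < 1/3, liminf_{n→∞} λₙ > 0 and βₙ → +∞. Then (xₙ) converges weakly to some x̄ ∈ S. -/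
open RealInnerProductSpace Filter Topology

variable {H : Type*} [NormedAddCommGroup H] [InnerProductSpace ℝ H]

/-- The solution set of the lower-level equilibrium problem: `S_f = {u ∈ K : f(u,y) ≥ 0 ∀ y ∈ K}`. -/
def Sf (K : Set H) (f : H → H → ℝ) : Set H := {u ∈ K | ∀ y ∈ K, 0 ≤ f u y}

/-- The solution set of the bilevel equilibrium problem:
`S = {x̄ ∈ S_f : g(x̄,y) ≥ 0 ∀ y ∈ S_f}`. -/
def Sol (K : Set H) (f g : H → H → ℝ) : Set H :=
  {u ∈ Sf K f | ∀ y ∈ Sf K f, 0 ≤ g u y}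

/-- `p` belongs to the normal cone of `C` at `u`. -/
def InNormalCone (C : Set H) (u p : H) : Prop :=
  u ∈ C ∧ ∀ z ∈ C, ⟪p, z - u⟫ ≤ 0

/-- `x` is a sequence generated by the inertial proximal algorithm (IPA). -/
def IPA (K : Set H) (f g : H → H → ℝ) (α : ℝ) (lam beta : ℕ → ℝ) (x : ℕ → H) : Prop :=
  (∀ n, x n ∈ K) ∧
  ∀ n, 1 ≤ n → ∀ y ∈ K,
    0 ≤ beta n * f (x (n + 1)) y + g (x (n + 1)) y +
      (1 / lam n) * ⟪x (n + 1) - (x n + α • (x n - x (n - 1))), y - x (n + 1)⟫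

/-- The geometric condition (GC) for a pair `(u, p)` with `p ∈ N_{S_f}(u)`:
for every `n` the supremum `Fₙ = sup_{y ∈ K} (⟨(2/βₙ)p, y⟩ + f(y,u))` is finite and the series
`∑ₙ λₙβₙ (Fₙ − (2/βₙ)⟨p,u⟩)` converges. -/
def GC (K : Set H) (f : H → H → ℝ) (lam beta : ℕ → ℝ) (u p : H) : Prop :=
  ∃ F : ℕ → ℝ,
    (∀ n, IsLUB {r : ℝ | ∃ y ∈ K, r = ⟪(2 / beta n) • p, y⟫ + f y u} (F n)) ∧
    Summable (fun n => lam n * beta n * (F n - (2 / beta n) * ⟪p, u⟫))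

/-- `h` is upper hemicontinuous on `K`:
`limsup_{t→0⁺} h(tz + (1−t)x, y) ≤ h(x,y)` for all `x, y, z ∈ K`. -/
def BifunUpperHemicontinuousOn {H : Type*} [NormedAddCommGroup H] [InnerProductSpace ℝ H]
    (K : Set H) (h : H → H → ℝ) : Prop :=
  ∀ x ∈ K, ∀ y ∈ K, ∀ z ∈ K,
    Filter.limsup (fun t : ℝ => h (t • z + (1 - t) • x) y) (nhdsWithin 0 (Set.Ioi 0)) ≤ h x y

/-- `h` is an equilibrium bifunction on `K`: `h(x,x) = 0` and `h(x,·)` is convex and lower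
semicontinuous on `K`, for every `x ∈ K`. -/
def EquilibriumBifun {H : Type*} [NormedAddCommGroup H] [InnerProductSpace ℝ H]
    (K : Set H) (h : H → H → ℝ) : Prop :=
  ∀ x ∈ K, h x x = 0 ∧ ConvexOn ℝ K (h x) ∧ LowerSemicontinuousOn (h x) K

/-- A closed convex set contains the weak limits of its points. -/
lemma mem_of_tendsto_inner [CompleteSpace H] {ι : Type*} {l : Filter ι} [l.NeBot] {C : Set H}
    (hcv : Convex ℝ C) (hcl : IsClosed C) {x : ι → H} {a : H} (hx : ∀ᶠ i in l, x i ∈ C)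
    (hlim : ∀ z, Tendsto (fun i => ⟪x i, z⟫) l (𝓝 ⟪a, z⟫)) : a ∈ C := by
  by_contra ha
  obtain ⟨φ, s, has, hs⟩ := geometric_hahn_banach_point_closed hcv hcl ha
  have hφ : ∀ y, φ y = ⟪y, (InnerProductSpace.toDual ℝ H).symm φ⟫ := fun y => by
    rw [real_inner_comm, InnerProductSpace.toDual_symm_apply]
  have h1 := ge_of_tendsto (hlim ((InnerProductSpace.toDual ℝ H).symm φ)) (b := s) <| by
    filter_upwards [hx] with i hi
    rw [← hφ]
    exact (hs _ hi).le
  rw [← hφ] at h1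
  linarith

/-- A convex lower semicontinuous function on a closed set is weakly lower semicontinuous. -/
lemma le_of_tendsto_inner [CompleteSpace H] {ι : Type*} {l : Filter ι} [l.NeBot] {K : Set H}
    (hK : IsClosed K) {φ : H → ℝ} (hcv : ConvexOn ℝ K φ) (hlsc : LowerSemicontinuousOn φ K)
    {x : ι → H} {a : H} (hx : ∀ i, x i ∈ K) {b : ι → ℝ} {r : ℝ}
    (hb : Tendsto b l (𝓝 r)) (hle : ∀ᶠ i in l, φ (x i) ≤ b i)
    (hlim : ∀ z, Tendsto (fun i => ⟪x i, z⟫) l (𝓝 ⟪a, z⟫)) : φ a ≤ r := by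
  refine le_of_forall_gt fun s hs => ?_
  obtain ⟨t, hrt, hts⟩ := exists_between hs
  obtain ⟨v, hv, hKv⟩ := lowerSemicontinuousOn_iff_preimage_Iic.1 hlsc t
  have hset : {y ∈ K | φ y ≤ t} = K ∩ v := hKv
  have hcl : IsClosed {y ∈ K | φ y ≤ t} := hset ▸ hK.inter hv
  have := mem_of_tendsto_inner (hcv.convex_le t) hcl (x := x) (a := a) (l := l) (by
    filter_upwards [hle, hb.eventually_lt_const hrt] with i h1 h2
    exact ⟨hx i, by linarith⟩) hlim
  exact this.2.trans_lt hts

/-- Minty's lemma for equilibrium bifunctions. -/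
lemma nonneg_of_forall_nonpos {C : Set H} (hC : Convex ℝ C) {h : H → H → ℝ}
    (hdiag : ∀ y ∈ C, h y y = 0) (hcv : ∀ y ∈ C, ConvexOn ℝ C (h y))
    (huhc : BifunUpperHemicontinuousOn C h) {a : H} (ha : a ∈ C) (hle : ∀ y ∈ C, h y a ≤ 0)
    {y : H} (hy : y ∈ C) : 0 ≤ h a y := by
  refine le_trans ?_ (huhc a ha y hy y hy)
  have hev : ∀ᶠ t : ℝ in 𝓝[>] 0, 0 ≤ h (t • y + (1 - t) • a) y := by
    filter_upwards [Ioo_mem_nhdsGT (zero_lt_one (α := ℝ))] with t ht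
    have hw : t • y + (1 - t) • a ∈ C := hC hy ha ht.1.le (by linarith [ht.2]) (by ring)
    have h1 := (hcv _ hw).2 hy ha ht.1.le (show 0 ≤ 1 - t by linarith [ht.2]) (by ring)
    rw [hdiag _ hw, smul_eq_mul, smul_eq_mul] at h1
    have h2 := mul_nonpos_of_nonneg_of_nonpos (show 0 ≤ 1 - t by linarith [ht.2]) (hle _ hw)
    exact nonneg_of_mul_nonneg_right (by linarith) ht.1
  rw [limsup_eq]
  refine Real.sInf_nonneg fun b hb => ?_
  obtain ⟨t, h1, h2⟩ := (hev.and hb).exists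
  exact h1.trans h2

/-- Bounded families in a Hilbert space converge weakly along ultrafilters. -/
lemma exists_tendsto_inner_of_bounded [CompleteSpace H] {ι : Type*} (U : Ultrafilter ι)
    {x : ι → H} {M : ℝ} (hM : ∀ i, ‖x i‖ ≤ M) :
    ∃ a : H, ∀ z, Tendsto (fun i => ⟪x i, z⟫) U (𝓝 ⟪a, z⟫) := by
  have hb : ∀ z i, |⟪x i, z⟫| ≤ M * ‖z‖ := fun z i =>
    (abs_real_inner_le_norm _ _).trans (by gcongr; exact hM i)
  have hex : ∀ z, ∃ c : ℝ, Tendsto (fun i => ⟪x i, z⟫) U (𝓝 c) := fun z => by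
    obtain ⟨c, -, hc⟩ := (isCompact_Icc (a := -(M * ‖z‖)) (b := M * ‖z‖)).ultrafilter_le_nhds
      (U.map fun i => ⟪x i, z⟫) (by
        simp only [le_principal_iff]
        exact mem_map.2 (Eventually.of_forall fun i => abs_le.1 (hb z i)))
    exact ⟨c, hc⟩
  choose L hL using hex
  let φ : H →ₗ[ℝ] ℝ :=
    { toFun := L
      map_add' := fun y z => tendsto_nhds_unique (hL (y + z)) (by
        simpa only [inner_add_right] using (hL y).add (hL z))
      map_smul' := fun c z => tendsto_nhds_unique (hL (c • z)) (by
        simpa only [inner_smul_right, RingHom.id_apply, smul_eq_mul] using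
          (hL z).const_mul c) }
  let ψ : H →L[ℝ] ℝ := φ.mkContinuous M fun z =>
    le_of_tendsto (hL z).abs (Eventually.of_forall (hb z))
  refine ⟨(InnerProductSpace.toDual ℝ H).symm ψ, fun z => ?_⟩
  rw [InnerProductSpace.toDual_symm_apply]
  exact hL z

/-- Opial's lemma, with weak cluster points taken along ultrafilters. -/
lemma exists_tendsto_inner_of_opial [CompleteSpace H] {S : Set H} (hS : S.Nonempty) {x : ℕ → H}
    (hconv : ∀ u ∈ S, ∃ c : ℝ, Tendsto (fun n => ‖x n - u‖ ^ 2) atTop (𝓝 c))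
    (hclus : ∀ (U : Ultrafilter ℕ) (a : H), (U : Filter ℕ) ≤ atTop →
      (∀ z, Tendsto (fun n => ⟪x n, z⟫) U (𝓝 ⟪a, z⟫)) → a ∈ S) :
    ∃ a ∈ S, ∀ z, Tendsto (fun n => ⟪x n, z⟫) atTop (𝓝 ⟪a, z⟫) := by
  obtain ⟨M, hM⟩ : ∃ M, ∀ n, ‖x n‖ ≤ M := by
    obtain ⟨u, hu⟩ := hS
    obtain ⟨c, hc⟩ := hconv u hu
    obtain ⟨B, hB⟩ := hc.bddAbove_range
    refine ⟨‖u‖ + (B + 1), fun n => ?_⟩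
    have h1 : ‖x n - u‖ ^ 2 ≤ B := hB ⟨n, rfl⟩
    have h2 : ‖x n‖ ≤ ‖x n - u‖ + ‖u‖ := by simpa using norm_add_le (x n - u) u
    nlinarith [sq_nonneg (‖x n - u‖ - 1)]
  have huniq : ∀ (U V : Ultrafilter ℕ) (a b : H), (U : Filter ℕ) ≤ atTop →
      (V : Filter ℕ) ≤ atTop → (∀ z, Tendsto (fun n => ⟪x n, z⟫) U (𝓝 ⟪a, z⟫)) →
      (∀ z, Tendsto (fun n => ⟪x n, z⟫) V (𝓝 ⟪b, z⟫)) → a = b := by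
    intro U V a b hU hV ha hb
    obtain ⟨c, hc⟩ := hconv a (hclus U a hU ha)
    obtain ⟨d, hd⟩ := hconv b (hclus V b hV hb)
    have hlim : Tendsto (fun n => ⟪x n, a - b⟫) atTop
        (𝓝 ((d - c + ‖a‖ ^ 2 - ‖b‖ ^ 2) / 2)) := by
      refine ((((hd.sub hc).add_const (‖a‖ ^ 2)).sub_const (‖b‖ ^ 2)).div_const 2).congr
        fun n => ?_
      rw [norm_sub_sq_real, norm_sub_sq_real, inner_sub_right]
      ring
    have h1 := tendsto_nhds_unique (ha (a - b)) (hlim.mono_left hU)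
    have h2 := tendsto_nhds_unique (hb (a - b)) (hlim.mono_left hV)
    have h3 : ⟪a - b, a - b⟫ = (0 : ℝ) := by rw [inner_sub_left, h1, h2, sub_self]
    exact sub_eq_zero.1 (inner_self_eq_zero.1 h3)
  obtain ⟨a, ha⟩ := exists_tendsto_inner_of_bounded (Ultrafilter.of (atTop : Filter ℕ)) hM
  refine ⟨a, hclus _ a (Ultrafilter.of_le _) ha, fun z => ?_⟩
  rw [tendsto_iff_ultrafilter]
  intro V hV
  obtain ⟨b, hb⟩ := exists_tendsto_inner_of_bounded V hM
  rw [huniq _ V a b (Ultrafilter.of_le _) hV ha hb]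
  exact hb z

/-- If `a (n + 1) - α * a n` converges with `0 ≤ α < 1`, then so does `a`. -/
lemma tendsto_of_tendsto_succ_sub_mul {α L : ℝ} (hα0 : 0 ≤ α) (hα1 : α < 1) {a : ℕ → ℝ}
    (h : Tendsto (fun n => a (n + 1) - α * a n) atTop (𝓝 L)) :
    Tendsto a atTop (𝓝 (L / (1 - α))) := by
  have hα : 0 < 1 - α := by linarith
  set c := L / (1 - α) with hc
  have hL : L = c * (1 - α) := by rw [hc]; field_simp
  rw [Metric.tendsto_atTop]
  intro e he
  obtain ⟨N, hN⟩ := Metric.tendsto_atTop.1 h (e / 2 * (1 - α)) (by positivity)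
  have hstep : ∀ k, |a (N + k) - c| ≤ α ^ k * |a N - c| + e / 2 := by
    intro k
    induction k with
    | zero => simp; positivity
    | succ k ih =>
      have h1 := hN (N + k) (by lia)
      rw [Real.dist_eq] at h1
      have h2 : a (N + (k + 1)) - c
          = (a (N + k + 1) - α * a (N + k) - L) + α * (a (N + k) - c) := by
        rw [hL, ← add_assoc]; ring
      have h3 := abs_add_le (a (N + k + 1) - α * a (N + k) - L) (α * (a (N + k) - c))
      rw [← h2, abs_mul, abs_of_nonneg hα0] at h3
      have h4 := mul_le_mul_of_nonneg_left ih hα0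
      rw [pow_succ]
      linarith
  have hpow : Tendsto (fun k => α ^ k * |a N - c|) atTop (𝓝 0) := by
    simpa using (tendsto_pow_atTop_nhds_zero_of_lt_one hα0 hα1).mul_const |a N - c|
  obtain ⟨k₀, hk₀⟩ := eventually_atTop.1 (hpow.eventually_lt_const (half_pos he))
  refine ⟨N + k₀, fun n hn => ?_⟩
  obtain ⟨k, rfl⟩ := Nat.exists_eq_add_of_le (show N ≤ n by lia)
  rw [Real.dist_eq]
  linarith [hstep k, hk₀ k (by lia)]

/-- Convergence for the scalar recursion satisfied by inertial proximal schemes. -/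
lemma inertial_recursion {α : ℝ} (hα0 : 0 ≤ α) (hα1 : α < 1 / 3) {φ δ ε : ℕ → ℝ}
    (hφ : ∀ n, 0 ≤ φ n) (hδ : ∀ n, 0 ≤ δ n) (hε : ∀ n, 0 ≤ ε n) (hsum : Summable ε)
    (hrec : ∀ n, φ (n + 2) - φ (n + 1) - α * (φ (n + 1) - φ n) ≤
      -(1 - α) * δ (n + 1) + 2 * α * δ n + ε n) :
    Tendsto δ atTop (𝓝 0) ∧ ∃ c : ℝ, Tendsto φ atTop (𝓝 c) := by
  set μ : ℕ → ℝ := fun n => φ (n + 1) - α * φ n + (1 - α) * δ n with hμ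
  have hdec : ∀ n, μ (n + 1) + (1 - 3 * α) * δ n ≤ μ n + ε n := fun n => by
    simp only [hμ]
    linarith [hrec n]
  have hE : ∀ n, ∑ k ∈ Finset.range n, ε k ≤ ∑' k, ε k := fun n =>
    hsum.sum_le_tsum _ fun k _ => hε k
  have htel : ∀ n, μ n + (1 - 3 * α) * ∑ k ∈ Finset.range n, δ k
      ≤ μ 0 + ∑ k ∈ Finset.range n, ε k := by
    intro n
    induction n with
    | zero => simp
    | succ n ih =>
      rw [Finset.sum_range_succ, Finset.sum_range_succ]
      linarith [hdec n]
  have hδsum : ∀ n, 0 ≤ ∑ k ∈ Finset.range n, δ k := fun n => Finset.sum_nonneg fun k _ => hδ k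
  have hα : 0 < 1 - 3 * α := by linarith
  set C := |μ 0 + ∑' k, ε k| with hC
  have hCμ : ∀ n, μ n + (1 - 3 * α) * ∑ k ∈ Finset.range n, δ k ≤ C := fun n => by
    linarith [htel n, hE n, le_abs_self (μ 0 + ∑' k, ε k)]
  set B := φ 0 + 2 * C with hB
  have hC0 : 0 ≤ C := abs_nonneg _
  have hbd : ∀ n, φ n ≤ B := by
    intro n
    induction n with
    | zero => linarith
    | succ n ih =>
      have h1 := hCμ n
      simp only [hμ] at h1
      have h2 := mul_nonneg hα.le (hδsum n)
      have h3 := mul_nonneg (show 0 ≤ 1 - α by linarith) (hδ n)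
      have h4 := mul_le_mul_of_nonneg_left ih hα0
      have h5 := mul_le_mul_of_nonneg_right hα1.le (show 0 ≤ B by linarith [hφ 0])
      linarith [hφ 0]
  have hμlow : ∀ n, -(α * B) ≤ μ n := fun n => by
    simp only [hμ]
    have h1 := mul_le_mul_of_nonneg_left (hbd n) hα0
    have h2 := mul_nonneg (show 0 ≤ 1 - α by linarith) (hδ n)
    linarith [hφ (n + 1)]
  have hδ0 : Tendsto δ atTop (𝓝 0) := by
    refine (summable_of_sum_range_le (c := (C + α * B) / (1 - 3 * α)) hδ fun n => ?_)
      |>.tendsto_atTop_zero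
    rw [le_div_iff₀ hα]
    linarith [hCμ n, hμlow n]
  refine ⟨hδ0, ?_⟩
  have hanti : Antitone fun n => μ n - ∑ k ∈ Finset.range n, ε k :=
    antitone_nat_of_succ_le fun n => by
      rw [Finset.sum_range_succ]
      linarith [hdec n, mul_nonneg hα.le (hδ n)]
  have hlim := tendsto_atTop_ciInf hanti
    ⟨-(α * B) - ∑' k, ε k, by rintro _ ⟨n, rfl⟩; simp only; linarith [hμlow n, hE n]⟩
  have h := (hlim.add hsum.hasSum.tendsto_sum_nat).sub (hδ0.const_mul (1 - α))
  exact ⟨_, tendsto_of_tendsto_succ_sub_mul (α := α) hα0 (by linarith)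
    (h.congr fun n => by simp only [hμ]; ring)⟩

lemma Sf_subset {K : Set H} {f : H → H → ℝ} : Sf K f ⊆ K := fun _ h => h.1

lemma BifunUpperHemicontinuousOn.mono {K C : Set H} {h : H → H → ℝ}
    (hh : BifunUpperHemicontinuousOn K h) (hC : C ⊆ K) : BifunUpperHemicontinuousOn C h :=
  fun x hx y hy z hz => hh x (hC hx) y (hC hy) z (hC hz)

section

variable {K : Set H} {f g : H → H → ℝ}

/-- The solution set coincides with the set of solutions of the dual (Minty) problem. -/
lemma mem_Sf_iff (hK : Convex ℝ K) (hmono : ∀ x ∈ K, ∀ y ∈ K, f x y + f y x ≤ 0)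
    (huhc : BifunUpperHemicontinuousOn K f) (heq : EquilibriumBifun K f) {u : H} :
    u ∈ Sf K f ↔ u ∈ K ∧ ∀ y ∈ K, f y u ≤ 0 :=
  ⟨fun h => ⟨h.1, fun y hy => by linarith [hmono u h.1 y hy, h.2 y hy]⟩,
   fun h => ⟨h.1, fun _ hy => nonneg_of_forall_nonpos hK (fun y hy => (heq y hy).1)
    (fun y hy => (heq y hy).2.1) huhc h.1 h.2 hy⟩⟩

lemma convex_Sf (hK : Convex ℝ K) (hmono : ∀ x ∈ K, ∀ y ∈ K, f x y + f y x ≤ 0)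
    (huhc : BifunUpperHemicontinuousOn K f) (heq : EquilibriumBifun K f) :
    Convex ℝ (Sf K f) := by
  intro u hu v hv a b ha hb hab
  rw [mem_Sf_iff hK hmono huhc heq] at hu hv ⊢
  refine ⟨hK hu.1 hv.1 ha hb hab, fun y hy => ?_⟩
  have h := (heq y hy).2.1.2 hu.1 hv.1 ha hb hab
  rw [smul_eq_mul, smul_eq_mul] at h
  linarith [mul_nonpos_of_nonneg_of_nonpos ha (hu.2 y hy),
    mul_nonpos_of_nonneg_of_nonpos hb (hv.2 y hy)]

/-- Weak limits of almost-solutions of the penalized problems solve the bilevel problem. -/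
lemma mem_Sol_of_tendsto_inner [CompleteSpace H] (hKcl : IsClosed K) (hKcv : Convex ℝ K)
    (hfmono : ∀ x ∈ K, ∀ y ∈ K, f x y + f y x ≤ 0)
    (hgmono : ∀ x ∈ K, ∀ y ∈ K, g x y + g y x ≤ 0)
    (hfUHC : BifunUpperHemicontinuousOn K f) (hfEq : EquilibriumBifun K f)
    (hgUHC : BifunUpperHemicontinuousOn K g) (hgEq : EquilibriumBifun K g)
    (hgsub : ∀ y ∈ K, ∃ xs : H, ∀ z ∈ K, ⟪xs, z - y⟫ ≤ g y z)
    {ι : Type*} {l : Filter ι} [l.NeBot] {w : ι → H} {a : H} {b : ι → ℝ} {r : H → ι → ℝ}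
    (hw : ∀ i, w i ∈ K) (hb0 : ∀ i, 0 < b i) (hb : Tendsto b l atTop)
    (hr : ∀ y, Tendsto (r y) l (𝓝 0))
    (hineq : ∀ y ∈ K, ∀ i, 0 ≤ b i * f (w i) y + g (w i) y + r y i)
    (hlim : ∀ z, Tendsto (fun i => ⟪w i, z⟫) l (𝓝 ⟪a, z⟫)) : a ∈ Sol K f g := by
  have haK : a ∈ K := mem_of_tendsto_inner hKcv hKcl (Eventually.of_forall hw) hlim
  have haS : a ∈ Sf K f := by
    rw [mem_Sf_iff hKcv hfmono hfUHC hfEq]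
    refine ⟨haK, fun y hy => ?_⟩
    obtain ⟨p, hp⟩ := hgsub y hy
    have h0 : Tendsto (fun i => (⟪p, y⟫ - ⟪w i, p⟫ + r y i) * (b i)⁻¹) l (𝓝 0) := by
      simpa using (((hlim p).const_sub ⟪p, y⟫).add (hr y)).mul hb.inv_tendsto_atTop
    refine le_of_tendsto_inner hKcl (hfEq y hy).2.1 (hfEq y hy).2.2 hw h0
      (Eventually.of_forall fun i => ?_) hlim
    have h1 := hp _ (hw i)
    rw [inner_sub_right, real_inner_comm] at h1
    rw [← div_eq_mul_inv, le_div_iff₀ (hb0 i)]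
    have h2 := mul_le_mul_of_nonneg_left (hfmono _ (hw i) y hy) (hb0 i).le
    linarith [hineq y hy i, hgmono _ (hw i) y hy]
  refine ⟨haS, fun y hy => nonneg_of_forall_nonpos (convex_Sf hKcv hfmono hfUHC hfEq)
    (fun y hy => (hgEq y hy.1).1)
    (fun y hy => (hgEq y hy.1).2.1.subset Sf_subset (convex_Sf hKcv hfmono hfUHC hfEq))
    (hgUHC.mono Sf_subset) haS (fun y hy => ?_) hy⟩
  refine le_of_tendsto_inner hKcl (hgEq y hy.1).2.1 (hgEq y hy.1).2.2 hw (hr y)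
    (Eventually.of_forall fun i => ?_) hlim
  have h1 : f (w i) y ≤ 0 := by linarith [hfmono _ (hw i) y hy.1, hy.2 _ (hw i)]
  linarith [hineq y hy.1 i, hgmono _ (hw i) y hy.1,
    mul_nonpos_of_nonneg_of_nonpos (hb0 i).le h1]

end

/-- The three-point estimate behind the inertial step `y = x₁ + α • (x₁ - x₀)`. -/
lemma inertial_step {α e : ℝ} (hα0 : 0 ≤ α) {x₀ x₁ x₂ u : H}
    (h : 2 * ⟪x₂ - (x₁ + α • (x₁ - x₀)), x₂ - u⟫ ≤ e) :
    ‖x₂ - u‖ ^ 2 - ‖x₁ - u‖ ^ 2 - α * (‖x₁ - u‖ ^ 2 - ‖x₀ - u‖ ^ 2) ≤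
      -(1 - α) * ‖x₂ - x₁‖ ^ 2 + 2 * α * ‖x₁ - x₀‖ ^ 2 + e := by
  obtain ⟨d, rfl⟩ : ∃ d, x₂ = x₁ + d := ⟨x₂ - x₁, by abel⟩
  obtain ⟨c, rfl⟩ : ∃ c, x₀ = x₁ - c := ⟨x₁ - x₀, by abel⟩
  obtain ⟨v, rfl⟩ : ∃ v, x₁ = u + v := ⟨x₁ - u, by abel⟩
  have e1 : u + v + d - u = v + d := by abel
  have e2 : u + v - u = v := by abel
  have e3 : u + v - c - u = v - c := by abel
  have e4 : u + v + d - (u + v) = d := by abel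
  have e5 : u + v - (u + v - c) = c := by abel
  have e6 : u + v + d - (u + v + α • c) = d - α • c := by abel
  rw [e5, e6, e1] at h
  rw [e1, e2, e3, e4, e5, norm_add_sq_real, norm_sub_sq_real]
  simp only [inner_sub_left, inner_add_right, inner_smul_left, real_inner_self_eq_norm_sq,
    conj_trivial] at h
  rw [real_inner_comm v d, real_inner_comm v c] at h
  have h1 := mul_nonneg hα0 (sq_nonneg ‖d - c‖)
  rw [norm_sub_sq_real, real_inner_comm] at h1
  linarith

theorem stmt7 {H : Type*} [NormedAddCommGroup H] [InnerProductSpace ℝ H] [CompleteSpace H]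
    (K : Set H) (hKne : K.Nonempty) (hKcl : IsClosed K) (hKcv : Convex ℝ K)
    (f g : H → H → ℝ)
    (hfmono : ∀ x ∈ K, ∀ y ∈ K, f x y + f y x ≤ 0)
    (hgmono : ∀ x ∈ K, ∀ y ∈ K, g x y + g y x ≤ 0)
    (hfUHC : BifunUpperHemicontinuousOn K f) (hfEq : EquilibriumBifun K f)
    (hgUHC : BifunUpperHemicontinuousOn K g) (hgEq : EquilibriumBifun K g)
    (hgsub : ∀ y ∈ K, ∃ xs : H, ∀ z ∈ K, ⟪xs, z - y⟫ ≤ g y z)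
    (α : ℝ) (hα0 : 0 ≤ α) (hα1 : α < 1 / 3)
    (lam beta : ℕ → ℝ) (hlam : ∀ n, 0 < lam n) (hbeta : ∀ n, 0 < beta n)
    (hSne : (Sol K f g).Nonempty)
    (hGC : ∀ u ∈ Sol K f g, ∃ p : H, InNormalCone (Sf K f) u p ∧
      (∀ y ∈ K, 0 ≤ g u y + ⟪p, y - u⟫) ∧ GC K f lam beta u p)
    (x : ℕ → H) (hx : IPA K f g α lam beta x)
    (hlaminf : ∃ c > (0 : ℝ), ∀ᶠ n in Filter.atTop, c ≤ lam n)
    (hbetaTop : Filter.Tendsto beta Filter.atTop Filter.atTop) :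
    ∃ xb ∈ Sol K f g,
      ∀ z : H, Filter.Tendsto (fun n => ⟪x n, z⟫) Filter.atTop (nhds ⟪xb, z⟫) := by
  obtain ⟨hxK, hstep⟩ := hx
  obtain ⟨c, hc, hlamc⟩ := hlaminf
  have key : ∀ u ∈ Sol K f g, Tendsto (fun n => ‖x (n + 1) - x n‖ ^ 2) atTop (𝓝 0) ∧
      ∃ c : ℝ, Tendsto (fun n => ‖x n - u‖ ^ 2) atTop (𝓝 c) := by
    intro u hu
    obtain ⟨p, -, hgp, F, hF, hsum⟩ := hGC u hu
    have huK : u ∈ K := hu.1.1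
    refine inertial_recursion hα0 hα1
      (ε := fun n => lam (n + 1) * beta (n + 1) * (F (n + 1) - (2 / beta (n + 1)) * ⟪p, u⟫))
      (fun n => by positivity) (fun n => by positivity) (fun n => ?_)
      ((summable_nat_add_iff 1).2 hsum) fun n => inertial_step hα0 ?_
    · refine mul_nonneg (mul_pos (hlam _) (hbeta _)).le (sub_nonneg.2 ((hF (n + 1)).1 ⟨u, huK, ?_⟩))
      rw [(hfEq u huK).1, real_inner_smul_left, add_zero]
    · have hw := hxK (n + 2)
      have hl := hlam (n + 1)
      have hb := hbeta (n + 1)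
      have h1 := hstep (n + 1) (by lia) u huK
      simp only [Nat.add_sub_cancel] at h1
      have h2 := (hF (n + 1)).1 ⟨x (n + 2), hw, rfl⟩
      rw [real_inner_smul_left] at h2
      have h3 := hgp _ hw
      have h4 := hgmono _ hw u huK
      have h5 : f (x (n + 2)) u ≤ 0 := by linarith [hfmono _ hw u huK, hu.1.2 _ hw]
      rw [inner_sub_right] at h3
      have h6 := mul_le_mul_of_nonneg_left h2 hb.le
      have h7 : beta (n + 1) * (2 / beta (n + 1)) = 2 := by field_simp
      rw [mul_add, ← mul_assoc, h7] at h6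
      have h8 : ⟪x (n + 2) - (x (n + 1) + α • (x (n + 1) - x n)), u - x (n + 2)⟫
          = -⟪x (n + 2) - (x (n + 1) + α • (x (n + 1) - x n)), x (n + 2) - u⟫ := by
        rw [← inner_neg_right, neg_sub]
      rw [h8] at h1
      have h9 := mul_nonpos_of_nonneg_of_nonpos hb.le h5
      have h10 : (1 / lam (n + 1)) *
          (2 * ⟪x (n + 2) - (x (n + 1) + α • (x (n + 1) - x n)), x (n + 2) - u⟫)
          ≤ beta (n + 1) * F (n + 1) - 2 * ⟪p, u⟫ := by linarith
      rw [one_div, inv_mul_le_iff₀ hl] at h10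
      refine h10.trans_eq ?_
      field_simp
  obtain ⟨u₀, hu₀⟩ := hSne
  have hδ := (key u₀ hu₀).1
  have hnorm : Tendsto (fun n => ‖x (n + 1) - x n‖) atTop (𝓝 0) := by
    simpa using hδ.sqrt
  obtain ⟨M, hM⟩ : ∃ M, ∀ n, ‖x n - u₀‖ ≤ M := by
    obtain ⟨d, hd⟩ := (key u₀ hu₀).2
    obtain ⟨B, hB⟩ := hd.bddAbove_range
    refine ⟨√B, fun n => Real.le_sqrt_of_sq_le (hB ⟨n, rfl⟩)⟩
  have hres : ∀ y, Tendsto (fun n => (1 / lam (n + 1)) *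
      ⟪x (n + 2) - (x (n + 1) + α • (x (n + 1) - x n)), y - x (n + 2)⟫) atTop (𝓝 0) := by
    intro y
    have hbound : Tendsto (fun n => (1 / c) *
        ((‖x (n + 2) - x (n + 1)‖ + α * ‖x (n + 1) - x n‖) * (‖y - u₀‖ + M))) atTop (𝓝 0) := by
      have := ((((tendsto_add_atTop_iff_nat 1).2 hnorm).add (hnorm.const_mul α)).mul_const
        (‖y - u₀‖ + M)).const_mul (1 / c)
      simpa using this
    refine squeeze_zero_norm' ?_ hbound
    filter_upwards [(tendsto_add_atTop_nat 1).eventually hlamc] with n hn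
    rw [norm_mul, Real.norm_of_nonneg (one_div_nonneg.2 (hlam _).le)]
    have h1 : ‖x (n + 2) - (x (n + 1) + α • (x (n + 1) - x n))‖
        ≤ ‖x (n + 2) - x (n + 1)‖ + α * ‖x (n + 1) - x n‖ := by
      rw [← sub_sub]
      refine (norm_sub_le _ _).trans_eq ?_
      rw [norm_smul, Real.norm_of_nonneg hα0]
    have h2 : ‖y - x (n + 2)‖ ≤ ‖y - u₀‖ + M := by
      have := norm_sub_le (y - u₀) (x (n + 2) - u₀)
      rw [sub_sub_sub_cancel_right] at this
      linarith [hM (n + 2)]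
    have h3 := (norm_inner_le_norm (𝕜 := ℝ)
      (x (n + 2) - (x (n + 1) + α • (x (n + 1) - x n))) (y - x (n + 2))).trans
      (mul_le_mul h1 h2 (norm_nonneg _) (by positivity))
    exact mul_le_mul (one_div_le_one_div_of_le hc hn) h3 (norm_nonneg _) (by positivity)
  obtain ⟨a, ha, hlim⟩ := exists_tendsto_inner_of_opial ⟨u₀, hu₀⟩ (x := fun n => x (n + 2))
    (fun u hu => (key u hu).2.imp fun d hd => (tendsto_add_atTop_iff_nat 2).2 hd)
    fun U a hU ha => mem_Sol_of_tendsto_inner hKcl hKcv hfmono hgmono hfUHC hfEq hgUHC hgEq hgsub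
      (fun n => hxK (n + 2)) (fun n => hbeta (n + 1))
      (((tendsto_add_atTop_iff_nat 1).2 hbetaTop).mono_left hU) (fun y => (hres y).mono_left hU)
      (fun y hy n => hstep (n + 1) (by lia) y hy) ha
  exact ⟨a, ha, fun z => (tendsto_add_atTop_iff_nat 2).1 (hlim z)⟩
end

section
/- (Strong convergence of (IPA) under the geometric condition.) Let f and g be monotone, upper hemicontinuous equilibrium bifunctions on K with g ρ-strongly monotone for some ρ > 0. Let u ∈ S and p ∈ N_{S_f}(u) satisfy g(u,y) + ⟨p, y − u⟩ ≥ 0 for all y ∈ K, and assume the geometric condition (GC) holds for the pair (u,p). Let (xₙ) be a sequence generated by the inertial proximal algorithm (IPA) with 0 ≤ α < 1/3 and ∑_{n=1}^∞ λₙ = +∞. Then u is the unique element of S and (xₙ) converges to u in norm, i.e., ‖xₙ − u‖ → 0. -/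
open RealInnerProductSpace Filter Topology

variable {H : Type*} [NormedAddCommGroup H] [InnerProductSpace ℝ H]

/-- A sequence satisfying a perturbed inertial Lyapunov inequality with a non-summable damping
term tends to zero. -/
theorem tendsto_zero_of_inertial_recurrence {a d ε l : ℕ → ℝ} {α c : ℝ}
    (hα0 : 0 ≤ α) (hα1 : α < 1 / 3) (hc : 0 < c)
    (ha : ∀ n, 0 ≤ a n) (hd : ∀ n, 0 ≤ d n) (hl : ∀ n, 0 < l n) (hε : ∀ n, 0 ≤ ε n)
    (hεs : Summable ε) (hls : ¬ Summable l)
    (h : ∀ n, a (n + 2) - a (n + 1) - α * (a (n + 1) - a n) ≤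
      -(1 - α) * d (n + 1) + 2 * α * d n + ε n - c * (l n * a (n + 2)))
    (had : ∀ n, |a (n + 1) - a n| ≤ √(d n) * (√(a (n + 1)) + √(a n))) :
    Tendsto a atTop (𝓝 0) := by
  let μ : ℕ → ℝ := fun n => a (n + 1) - α * a n + 2 * α * d n
  let w : ℕ → ℝ := fun n => (1 - 3 * α) * d (n + 1) + c * (l n * a (n + 2))
  let E : ℕ → ℝ := fun n => ∑ i ∈ Finset.range n, ε i
  have hE : ∀ n, E n ≤ ∑' i, ε i := fun n => hεs.sum_le_tsum _ fun i _ => hε i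
  have hEs : ∀ n, E (n + 1) = E n + ε n := fun n => Finset.sum_range_succ _ _
  have hla : ∀ n, 0 ≤ l n * a (n + 2) := fun n => mul_nonneg (hl n).le (ha _)
  have hda : ∀ n, 0 ≤ (1 - 3 * α) * d n := fun n => mul_nonneg (by linarith) (hd _)
  have hαd : ∀ n, 0 ≤ α * d n := fun n => mul_nonneg hα0 (hd _)
  have hw : ∀ n, 0 ≤ w n := fun n => add_nonneg (hda _) (mul_nonneg hc.le (hla n))
  have hstep : ∀ n, μ (n + 1) + w n ≤ μ n + ε n := by
    intro n
    have := h n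
    simp only [μ, w, add_assoc, Nat.reduceAdd] at this ⊢
    linarith
  have hsum : ∀ n, μ n + ∑ i ∈ Finset.range n, w i ≤ μ 0 + E n := by
    intro n
    induction n with
    | zero => simp [E]
    | succ n ih =>
      rw [Finset.sum_range_succ, hEs]
      linarith [hstep n]
  have hwsum : ∀ n, 0 ≤ ∑ i ∈ Finset.range n, w i := fun n => Finset.sum_nonneg fun i _ => hw i
  obtain ⟨M, hM0, hM⟩ : ∃ M, a 0 ≤ M ∧ μ 0 + ∑' i, ε i ≤ (1 - α) * M := by
    refine ⟨max (a 0) ((μ 0 + ∑' i, ε i) / (1 - α)), le_max_left _ _, ?_⟩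
    rw [mul_comm, ← div_le_iff₀ (by linarith)]
    exact le_max_right _ _
  have haM : ∀ n, a n ≤ M := by
    intro n
    induction n with
    | zero => exact hM0
    | succ n ih =>
      have h1 : a (n + 1) - α * a n + 2 * α * d n + _ ≤ _ := hsum n
      linarith [hwsum n, hE n, hαd n, mul_le_mul_of_nonneg_left ih hα0]
  have hμlow : ∀ n, -(α * M) ≤ μ n := by
    intro n
    linarith [ha (n + 1), hαd n, mul_le_mul_of_nonneg_left (haM n) hα0,
      show μ n = a (n + 1) - α * a n + 2 * α * d n from rfl]
  have hws : Summable w := by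
    refine summable_of_sum_range_le (c := μ 0 + ∑' i, ε i + α * M) hw fun n => ?_
    linarith [hsum n, hE n, hμlow n]
  have hdlim : Tendsto d atTop (𝓝 0) := by
    have h1 : Tendsto (fun n => (1 - 3 * α) * d (n + 1)) atTop (𝓝 0) :=
      squeeze_zero (fun n => hda _)
        (fun n => le_add_of_nonneg_right (mul_nonneg hc.le (hla n))) hws.tendsto_atTop_zero
    have h2 := h1.const_mul (1 - 3 * α)⁻¹
    have h3 : 1 - 3 * α ≠ 0 := by linarith
    simp only [inv_mul_cancel_left₀ h3, mul_zero] at h2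
    exact (tendsto_add_atTop_iff_nat 1).1 h2
  obtain ⟨L, hL⟩ : ∃ L, Tendsto μ atTop (𝓝 L) := by
    have hanti : Antitone fun n => μ n - E n :=
      antitone_nat_of_succ_le fun n => by linarith [hstep n, hw n, hEs n]
    have hbdd : BddBelow (Set.range fun n => μ n - E n) := by
      refine ⟨-(α * M) - ∑' i, ε i, ?_⟩
      rintro _ ⟨n, rfl⟩
      exact sub_le_sub (hμlow n) (hE n)
    have := (tendsto_atTop_ciInf hanti hbdd).add hεs.hasSum.tendsto_sum_nat
    exact ⟨_, this.congr fun n => sub_add_cancel _ _⟩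
  have hdiff : Tendsto (fun n => a (n + 1) - a n) atTop (𝓝 0) := by
    have h1 : Tendsto (fun n => √(d n) * (√M + √M)) atTop (𝓝 0) := by
      simpa using (hdlim.sqrt).mul_const (√M + √M)
    refine squeeze_zero_norm (fun n => (had n).trans ?_) h1
    gcongr <;> exact haM _
  obtain ⟨r, hr⟩ : ∃ r, Tendsto (fun n => a (n + 1)) atTop (𝓝 r) := by
    have h1 := ((hL.sub (hdiff.const_mul α)).sub (hdlim.const_mul (2 * α))).const_mul (1 - α)⁻¹
    refine ⟨_, h1.congr fun n => ?_⟩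
    have h2 : 1 - α ≠ 0 := by linarith
    rw [inv_mul_eq_iff_eq_mul₀ h2]
    simp only [μ]
    ring
  have hr0 : r = 0 := by
    by_contra hne
    have hrpos : 0 < r :=
      lt_of_le_of_ne (ge_of_tendsto' hr fun n => ha _) (Ne.symm hne)
    have hlas : Summable fun n => l n * a (n + 2) := by
      have : Summable fun n => c * (l n * a (n + 2)) :=
        hws.of_nonneg_of_le (fun n => mul_nonneg hc.le (hla n))
          fun n => le_add_of_nonneg_left (hda _)
      exact (summable_mul_left_iff hc.ne').1 this
    obtain ⟨N, hN⟩ := eventually_atTop.1 (hr.eventually (lt_mem_nhds (half_lt_self hrpos)))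
    apply hls
    rw [← summable_nat_add_iff N]
    have h1 := ((summable_nat_add_iff N).2 hlas).mul_left (r / 2)⁻¹
    refine h1.of_nonneg_of_le (fun n => (hl _).le) fun n => ?_
    rw [le_inv_mul_iff₀ (by positivity), mul_comm]
    exact mul_le_mul_of_nonneg_left (hN (n + N + 1) (by omega)).le (hl _).le
  rw [← tendsto_add_atTop_iff_nat 1, ← hr0]
  exact hr

/-- Energy estimate for one inertial step from `y = b + α (b - a)` to `z`. -/
theorem inertial_step_estimate {H : Type*} [NormedAddCommGroup H] [InnerProductSpace ℝ H]
    (a b z u : H) {α : ℝ} (hα0 : 0 ≤ α) :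
    ‖z - u‖ ^ 2 - ‖b - u‖ ^ 2 - α * (‖b - u‖ ^ 2 - ‖a - u‖ ^ 2) ≤
      -(1 - α) * ‖z - b‖ ^ 2 + 2 * α * ‖b - a‖ ^ 2 -
        2 * ⟪z - (b + α • (b - a)), u - z⟫ := by
  obtain ⟨A, rfl⟩ : ∃ A, a = u + A := ⟨a - u, by abel⟩
  obtain ⟨B, rfl⟩ : ∃ B, b = u + B := ⟨b - u, by abel⟩
  obtain ⟨Z, rfl⟩ : ∃ Z, z = u + Z := ⟨z - u, by abel⟩
  have key := mul_nonneg hα0 (sq_nonneg ‖(Z - B) - (B - A)‖)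
  have e1 : u + Z - (u + B + α • (u + B - (u + A))) = Z - B - α • (B - A) := by
    simp only [add_sub_add_left_eq_sub]; abel
  have e2 : u - (u + Z) = -Z := by abel
  rw [e1, e2]
  simp only [add_sub_cancel_left, add_sub_add_left_eq_sub]
  simp only [← real_inner_self_eq_norm_sq, inner_sub_left, inner_sub_right, inner_neg_right,
    real_inner_smul_left] at key ⊢
  rw [real_inner_comm Z B, real_inner_comm Z A, real_inner_comm B A] at *
  linarith

theorem abs_sq_norm_sub_sq_norm_le {E : Type*} [SeminormedAddCommGroup E] (v w : E) :
    |‖v‖ ^ 2 - ‖w‖ ^ 2| ≤ √(‖v - w‖ ^ 2) * (√(‖v‖ ^ 2) + √(‖w‖ ^ 2)) := by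
  simp only [Real.sqrt_sq (norm_nonneg _)]
  rw [sq_sub_sq, abs_mul, abs_of_nonneg (by positivity : 0 ≤ ‖v‖ + ‖w‖), mul_comm]
  exact mul_le_mul_of_nonneg_right (abs_norm_sub_norm_le v w) (by positivity)

theorem Sol_eq_singleton {H : Type*} [NormedAddCommGroup H] [InnerProductSpace ℝ H]
    {K : Set H} {f g : H → H → ℝ} {ρ : ℝ} (hρ : 0 < ρ)
    (hgstrong : ∀ x ∈ K, ∀ y ∈ K, g x y + g y x ≤ -ρ * ‖x - y‖ ^ 2)
    {u : H} (hu : u ∈ Sol K f g) : Sol K f g = {u} := by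
  refine Set.eq_singleton_iff_unique_mem.2 ⟨hu, fun v hv => ?_⟩
  have h1 := hgstrong v hv.1.1 u hu.1.1
  have h2 : ρ * ‖v - u‖ ^ 2 ≤ 0 := by linarith [hv.2 u hu.1, hu.2 v hv.1]
  have h3 : ‖v - u‖ ^ 2 ≤ 0 := nonpos_of_mul_nonpos_right h2 hρ
  exact sub_eq_zero.1 (norm_eq_zero.1 (pow_eq_zero_iff two_ne_zero |>.1 (h3.antisymm (sq_nonneg _))))

theorem stmt8 {H : Type*} [NormedAddCommGroup H] [InnerProductSpace ℝ H] [CompleteSpace H]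
    (K : Set H) (hKne : K.Nonempty) (hKcl : IsClosed K) (hKcv : Convex ℝ K)
    (f g : H → H → ℝ)
    (hfmono : ∀ x ∈ K, ∀ y ∈ K, f x y + f y x ≤ 0)
    (hgmono : ∀ x ∈ K, ∀ y ∈ K, g x y + g y x ≤ 0)
    (hfUHC : BifunUpperHemicontinuousOn K f) (hfEq : EquilibriumBifun K f)
    (hgUHC : BifunUpperHemicontinuousOn K g) (hgEq : EquilibriumBifun K g)
    (ρ : ℝ) (hρ : 0 < ρ)
    (hgstrong : ∀ x ∈ K, ∀ y ∈ K, g x y + g y x ≤ -ρ * ‖x - y‖ ^ 2)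
    (α : ℝ) (hα0 : 0 ≤ α) (hα1 : α < 1 / 3)
    (lam beta : ℕ → ℝ) (hlam : ∀ n, 0 < lam n) (hbeta : ∀ n, 0 < beta n)
    (u : H) (hu : u ∈ Sol K f g)
    (p : H) (hp : InNormalCone (Sf K f) u p)
    (hpg : ∀ y ∈ K, 0 ≤ g u y + ⟪p, y - u⟫)
    (hGC : GC K f lam beta u p)
    (x : ℕ → H) (hx : IPA K f g α lam beta x)
    (hlamdiv : ¬ Summable lam) :
    Sol K f g = {u} ∧
      Filter.Tendsto (fun n => ‖x n - u‖) Filter.atTop (nhds 0) := by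
  refine ⟨Sol_eq_singleton hρ hgstrong hu, ?_⟩
  obtain ⟨F, hF, hsum⟩ := hGC
  obtain ⟨hxK, hstep⟩ := hx
  have huK : u ∈ K := hu.1.1
  have hFle : ∀ n, ∀ y ∈ K, beta n * f y u + 2 * ⟪p, y⟫ ≤ beta n * F n := by
    intro n y hy
    have h1 : ⟪(2 / beta n) • p, y⟫ + f y u ≤ F n := (hF n).1 ⟨y, hy, rfl⟩
    rw [real_inner_smul_left] at h1
    have h2 := mul_le_mul_of_nonneg_left h1 (hbeta n).le
    have h3 : beta n * (2 / beta n * ⟪p, y⟫ + f y u) = beta n * f y u + 2 * ⟪p, y⟫ := by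
      have := (hbeta n).ne'
      field_simp
      ring
    linarith
  have hgap : ∀ n, lam n * beta n * (F n - 2 / beta n * ⟪p, u⟫) =
      lam n * (beta n * F n - 2 * ⟪p, u⟫) := by
    intro n
    have := (hbeta n).ne'
    field_simp
  simp only [hgap] at hsum
  have hsq : Tendsto (fun n => ‖x n - u‖ ^ 2) atTop (𝓝 0) := by
    refine tendsto_zero_of_inertial_recurrence (d := fun n => ‖x (n + 1) - x n‖ ^ 2)
      (ε := fun n => lam (n + 1) * (beta (n + 1) * F (n + 1) - 2 * ⟪p, u⟫))
      (l := fun n => lam (n + 1)) (c := 2 * ρ) hα0 hα1 (by positivity)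
      (fun n => sq_nonneg _) (fun n => sq_nonneg _) (fun n => hlam _) (fun n => ?_)
      ((summable_nat_add_iff 1).2 hsum) (fun h => hlamdiv ((summable_nat_add_iff 1).1 h))
      (fun n => ?_) (fun n => ?_)
    · refine mul_nonneg (hlam _).le ?_
      have := hFle (n + 1) u huK
      rw [(hfEq u huK).1] at this
      linarith
    · have hz := hxK (n + 2)
      have h1 := hstep (n + 1) (by omega) u huK
      simp only [add_assoc, Nat.reduceAdd, add_tsub_cancel_right] at h1
      have h2 := mul_nonneg (hlam (n + 1)).le h1
      rw [← add_assoc, mul_add, ← mul_assoc (lam (n + 1)) (1 / lam (n + 1)),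
        mul_one_div_cancel (hlam (n + 1)).ne', one_mul] at h2
      have h3 := inertial_step_estimate (x n) (x (n + 1)) (x (n + 2)) u hα0
      have hf0 : f (x (n + 2)) u ≤ 0 := by
        linarith [hfmono _ hz u huK, hu.1.2 _ hz]
      have hpx := hpg _ hz
      rw [inner_sub_right] at hpx
      have h4 : 2 * (beta (n + 1) * f (x (n + 2)) u + g (x (n + 2)) u) ≤
          beta (n + 1) * F (n + 1) - 2 * ⟪p, u⟫ - 2 * ρ * ‖x (n + 2) - u‖ ^ 2 := by
        linarith [hFle (n + 1) _ hz, hgstrong _ hz u huK,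
          mul_nonpos_of_nonneg_of_nonpos (hbeta (n + 1)).le hf0]
      have h5 := mul_le_mul_of_nonneg_left h4 (hlam (n + 1)).le
      linarith
    · simpa using abs_sq_norm_sub_sq_norm_le (x (n + 1) - u) (x n - u)
  simpa [Real.sqrt_sq (norm_nonneg _)] using hsq.sqrt
end

section
/- (Strong convergence of (IPA) without the geometric condition.) Let f and g be monotone, upper hemicontinuous equilibrium bifunctions on K with S_f nonempty, g ρ-strongly monotone for some ρ > 0, and such that for each y ∈ K there exists x* ∈ H with g(y,z) ≥ ⟨x*, z − y⟩ for all z ∈ K. Assume x̄ ∈ S. Let (xₙ) be a sequence generated by the inertial proximal algorithm (IPA) with 0 ≤ α < 1/3, λₙ → 0, ∑_{n=0}^∞ λₙ = +∞, βₙ → +∞ and liminf_{n→∞} λₙβₙ > 0. Then x̄ is the unique element of S and (xₙ) converges to x̄ in norm, i.e., ‖xₙ − x̄‖ → 0. -/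
open RealInnerProductSpace Filter Topology

variable {H : Type*} [NormedAddCommGroup H] [InnerProductSpace ℝ H]

section Auxiliary

variable {H : Type*} [NormedAddCommGroup H] [InnerProductSpace ℝ H] {ι : Type*}

theorem exists_ultrafilter_tendsto_inner [CompleteSpace H] {F : Filter ι} [F.NeBot] {z : ι → H}
    {R : ℝ} (hz : ∀ᶠ i in F, ‖z i‖ ≤ R) :
    ∃ (U : Ultrafilter ι) (w : H), ↑U ≤ F ∧ ∀ v : H, Tendsto (fun i => ⟪z i, v⟫) U (𝓝 ⟪w, v⟫) := by
  let U := Ultrafilter.of F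
  have hU : ↑U ≤ F := Ultrafilter.of_le F
  let T : ι → WeakDual ℝ H := fun i => StrongDual.toWeakDual (InnerProductSpace.toDual ℝ H (z i))
  have hc := WeakDual.isCompact_closedBall (𝕜 := ℝ) (E := H) 0 R
  have hmem : ∀ᶠ i in (U : Filter ι), T i ∈
      WeakDual.toStrongDual ⁻¹' Metric.closedBall (0 : StrongDual ℝ H) R := by
    filter_upwards [hU hz] with i hi
    have h : ‖InnerProductSpace.toDual ℝ H (z i)‖ ≤ R := by simpa using hi
    exact mem_closedBall_zero_iff.2 h
  obtain ⟨φ, -, hφ⟩ := hc.ultrafilter_le_nhds (U.map T) (le_principal_iff.2 hmem)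
  have hφ' : Tendsto T U (𝓝 φ) := hφ
  refine ⟨U, (InnerProductSpace.toDual ℝ H).symm (WeakDual.toStrongDual φ), hU, fun v => ?_⟩
  rw [InnerProductSpace.toDual_symm_apply]
  exact (tendsto_iff_forall_eval_tendsto_topDualPairing.1 hφ') v

theorem mem_of_tendsto_inner_s9 [CompleteSpace H] {F : Filter ι} [F.NeBot] {z : ι → H} {w : H}
    (hw : ∀ v : H, Tendsto (fun i => ⟪z i, v⟫) F (𝓝 ⟪w, v⟫)) {C : Set H}
    (hCcv : Convex ℝ C) (hCcl : IsClosed C) (hz : ∀ᶠ i in F, z i ∈ C) : w ∈ C := by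
  by_contra hwC
  obtain ⟨φ, c, hφw, hφC⟩ := geometric_hahn_banach_point_closed hCcv hCcl hwC
  have hφ (a : H) : φ a = ⟪a, (InnerProductSpace.toDual ℝ H).symm φ⟫ := by
    rw [real_inner_comm, InnerProductSpace.toDual_symm_apply]
  have hlim := hw ((InnerProductSpace.toDual ℝ H).symm φ)
  simp_rw [← hφ] at hlim
  exact absurd (ge_of_tendsto hlim (hz.mono fun i hi => (hφC _ hi).le)) (not_le.2 hφw)

theorem isClosed_sublevel {X : Type*} [TopologicalSpace X] {K : Set X} (hK : IsClosed K) {φ : X → ℝ}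
    (hφ : LowerSemicontinuousOn φ K) (r : ℝ) : IsClosed {z ∈ K | φ z ≤ r} := by
  obtain ⟨v, hv, h⟩ := lowerSemicontinuousOn_iff_preimage_Iic.1 hφ r
  have : {z ∈ K | φ z ≤ r} = K ∩ v := by rw [← h]; rfl
  rw [this]
  exact hK.inter hv

/-- Minty's lemma: solutions of the dual equilibrium problem solve the equilibrium problem. -/
theorem mem_Sf_of_forall_nonpos {K : Set H} (hK : Convex ℝ K) {f : H → H → ℝ}
    (hUHC : BifunUpperHemicontinuousOn K f) (hEq : EquilibriumBifun K f) {u : H} (hu : u ∈ K)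
    (h : ∀ y ∈ K, f y u ≤ 0) : u ∈ Sf K f := by
  refine ⟨hu, fun y hy => le_trans ?_ (hUHC u hu y hy y hy)⟩
  have hpos : ∀ᶠ t : ℝ in 𝓝[>] 0, 0 ≤ f (t • y + (1 - t) • u) y := by
    filter_upwards [Ioo_mem_nhdsGT (zero_lt_one' ℝ)] with t ht
    have h1 : (0 : ℝ) ≤ 1 - t := by linarith [ht.2]
    have hm : t • y + (1 - t) • u ∈ K := hK hy hu ht.1.le h1 (by ring)
    obtain ⟨h0, hcv, -⟩ := hEq _ hm
    have hle := hcv.2 hy hu ht.1.le h1 (by ring)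
    rw [h0] at hle
    simp only [smul_eq_mul] at hle
    have := mul_nonpos_of_nonneg_of_nonpos h1 (h _ hm)
    exact nonneg_of_mul_nonneg_right (by linarith) ht.1
  rw [Filter.limsup_eq]
  refine Real.sInf_nonneg fun a ha => ?_
  obtain ⟨t, ht0, hta⟩ := (hpos.and ha).exists
  exact ht0.trans hta

/-- A bounded net in `K` that is asymptotically a solution of the dual lower-level problem has
asymptotically nonnegative values of `g u` when `u` solves the bilevel problem. -/
theorem eventually_neg_lt_of_mem_Sol [CompleteSpace H] {K : Set H} (hKcl : IsClosed K)
    (hKcv : Convex ℝ K) {f g : H → H → ℝ} (hfUHC : BifunUpperHemicontinuousOn K f)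
    (hfEq : EquilibriumBifun K f) (hgEq : EquilibriumBifun K g) {u : H} (hu : u ∈ Sol K f g)
    {F : Filter ι} {z : ι → H} (hzK : ∀ i, z i ∈ K) {R : ℝ} (hz : ∀ᶠ i in F, ‖z i‖ ≤ R)
    (hf : ∀ y ∈ K, ∀ δ > 0, ∀ᶠ i in F, f y (z i) ≤ δ) {ε : ℝ} (hε : 0 < ε) :
    ∀ᶠ i in F, -ε < g u (z i) := by
  by_contra hcon
  have hfreq : ∃ᶠ i in F, g u (z i) ≤ -ε := by simpa [Filter.not_eventually] using hcon
  let G := F ⊓ 𝓟 {i | g u (z i) ≤ -ε}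
  have : G.NeBot := Filter.frequently_mem_iff_neBot.1 hfreq
  have hGF : G ≤ F := inf_le_left
  have hG : ∀ᶠ i in G, g u (z i) ≤ -ε := (inf_le_right : G ≤ _) (mem_principal_self _)
  obtain ⟨U, w, hUG, hw⟩ := exists_ultrafilter_tendsto_inner (hGF hz)
  have hwK : w ∈ K := mem_of_tendsto_inner_s9 hw hKcv hKcl (Eventually.of_forall hzK)
  have key (φ : H → ℝ) (h1 : ConvexOn ℝ K φ) (h2 : LowerSemicontinuousOn φ K) (r : ℝ)
      (h3 : ∀ᶠ i in G, φ (z i) ≤ r) : φ w ≤ r :=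
    (mem_of_tendsto_inner_s9 hw (h1.convex_le r) (isClosed_sublevel hKcl h2 r)
      ((h3.filter_mono hUG).mono fun i hi => ⟨hzK i, hi⟩)).2
  have hwS : w ∈ Sf K f := mem_Sf_of_forall_nonpos hKcv hfUHC hfEq hwK fun y hy =>
    le_of_forall_pos_le_add fun δ hδ => by
      simpa using key (f y) (hfEq y hy).2.1 (hfEq y hy).2.2 δ (hGF (hf y hy δ hδ))
  have h1 := key (g u) (hgEq u hu.1.1).2.1 (hgEq u hu.1.1).2.2 (-ε) hG
  linarith [hu.2 w hwS]

/-- Energy inequality for the inertial extrapolation step. -/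
theorem inertial_inner_lower_bound {α : ℝ} (hα : 0 ≤ α) (p q r u : H) :
    ‖p - u‖ ^ 2 - (1 + α) * ‖q - u‖ ^ 2 + α * ‖r - u‖ ^ 2 - 2 * α * ‖q - r‖ ^ 2
      + (1 - α) * ‖p - q‖ ^ 2 ≤ 2 * ⟪p - (q + α • (q - r)), p - u⟫ := by
  have h : 2 * ⟪p - (q + α • (q - r)), p - u⟫ = ‖p - u‖ ^ 2 - (1 + α) * ‖q - u‖ ^ 2
      + α * ‖r - u‖ ^ 2 - 2 * α * ‖q - r‖ ^ 2 + (1 - α) * ‖p - q‖ ^ 2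
      + α * ‖(p - q) - (q - r)‖ ^ 2 := by
    simp only [← real_inner_self_eq_norm_sq, inner_sub_left, inner_sub_right, inner_add_left,
      inner_smul_left, real_inner_comm p q, real_inner_comm p r, real_inner_comm p u,
      real_inner_comm q r, real_inner_comm q u, real_inner_comm r u, conj_trivial]
    ring
  rw [h]
  linarith [mul_nonneg hα (sq_nonneg ‖(p - q) - (q - r)‖)]

theorem inertial_energy_lower_bound {V : Type*} [SeminormedAddCommGroup V] {α γ : ℝ} (hα0 : 0 ≤ α)
    (hα1 : α < 1 / 3) (hγ : 2 * α ≤ γ) (q r u : V) :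
    ‖q - u‖ ^ 2 / 3 ≤ ‖q - u‖ ^ 2 - α * ‖r - u‖ ^ 2 + γ * ‖q - r‖ ^ 2 := by
  have htri : ‖r - u‖ ≤ ‖q - u‖ + ‖q - r‖ := by
    have h := norm_sub_le (q - u) (q - r)
    rwa [show (q - u) - (q - r) = r - u by abel] at h
  have hsq : ‖r - u‖ ^ 2 ≤ 2 * ‖q - u‖ ^ 2 + 2 * ‖q - r‖ ^ 2 := by
    nlinarith [norm_nonneg (r - u), sq_nonneg (‖q - u‖ - ‖q - r‖)]
  nlinarith [mul_le_mul_of_nonneg_left hsq hα0, sq_nonneg ‖q - u‖,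
    mul_nonneg (sub_nonneg.2 hγ) (sq_nonneg ‖q - r‖)]

end Auxiliary

/-- A nonnegative sequence that is small after every step without sufficient decrease is
eventually small. -/
theorem eventually_le_of_insufficient_decrease {E l : ℕ → ℝ} {κ T : ℝ} (hκ : 0 < κ)
    (hE : ∀ n, 0 ≤ E n) (hl : ∀ n, 0 < l n) (hdiv : ¬ Summable l)
    (h : ∀ᶠ n in atTop, E n - κ * l n ≤ E (n + 1) → E (n + 1) ≤ T) :
    ∀ᶠ n in atTop, E n ≤ T := by
  obtain ⟨N, hN⟩ := eventually_atTop.1 h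
  obtain ⟨m, hmN, hm⟩ : ∃ m ≥ N, E m - κ * l m ≤ E (m + 1) := by
    by_contra! hcon
    refine hdiv ((summable_nat_add_iff N).1 ?_)
    refine summable_of_sum_range_le (c := E N / κ) (fun n => (hl _).le) fun n => ?_
    have hsum : κ * ∑ i ∈ Finset.range n, l (i + N) ≤ E N - E (n + N) := by
      induction n with
      | zero => simp
      | succ k ih =>
        rw [Finset.sum_range_succ, mul_add]
        have := hcon (k + N) (by omega)
        rw [show k + 1 + N = k + N + 1 by omega]
        linarith
    rw [le_div_iff₀ hκ]
    linarith [hE (n + N)]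
  refine eventually_atTop.2 ⟨m + 1, fun n hn => ?_⟩
  induction n, hn using Nat.le_induction with
  | base => exact hN m hmN hm
  | succ k hk ih =>
    by_cases hb : E k - κ * l k ≤ E (k + 1)
    · exact hN k (by omega) hb
    · linarith [mul_pos hκ (hl k)]

theorem stmt9 {H : Type*} [NormedAddCommGroup H] [InnerProductSpace ℝ H] [CompleteSpace H]
    (K : Set H) (hKne : K.Nonempty) (hKcl : IsClosed K) (hKcv : Convex ℝ K)
    (f g : H → H → ℝ)
    (hfmono : ∀ x ∈ K, ∀ y ∈ K, f x y + f y x ≤ 0)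
    (hgmono : ∀ x ∈ K, ∀ y ∈ K, g x y + g y x ≤ 0)
    (hfUHC : BifunUpperHemicontinuousOn K f) (hfEq : EquilibriumBifun K f)
    (hgUHC : BifunUpperHemicontinuousOn K g) (hgEq : EquilibriumBifun K g)
    (hSfne : (Sf K f).Nonempty)
    (ρ : ℝ) (hρ : 0 < ρ)
    (hgstrong : ∀ x ∈ K, ∀ y ∈ K, g x y + g y x ≤ -ρ * ‖x - y‖ ^ 2)
    (hgsub : ∀ y ∈ K, ∃ xs : H, ∀ z ∈ K, ⟪xs, z - y⟫ ≤ g y z)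
    (xb : H) (hxb : xb ∈ Sol K f g)
    (α : ℝ) (hα0 : 0 ≤ α) (hα1 : α < 1 / 3)
    (lam beta : ℕ → ℝ) (hlam : ∀ n, 0 < lam n) (hbeta : ∀ n, 0 < beta n)
    (x : ℕ → H) (hx : IPA K f g α lam beta x)
    (hlam0 : Filter.Tendsto lam Filter.atTop (nhds 0))
    (hlamdiv : ¬ Summable lam)
    (hbetaTop : Filter.Tendsto beta Filter.atTop Filter.atTop)
    (hlambeta : ∃ c > (0 : ℝ), ∀ᶠ n in Filter.atTop, c ≤ lam n * beta n) :
    Sol K f g = {xb} ∧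
      Filter.Tendsto (fun n => ‖x n - xb‖) Filter.atTop (nhds 0) := by
  obtain ⟨hxK, hxI⟩ := hx
  have huK : xb ∈ K := hxb.1.1
  obtain ⟨c, hc, hcl⟩ := hlambeta
  obtain ⟨p, hp⟩ := hgsub xb huK
  refine ⟨Set.eq_singleton_iff_unique_mem.2 ⟨hxb, fun v hv => ?_⟩, ?_⟩
  · have h1 := hgstrong v hv.1.1 xb huK
    have h2 := hv.2 xb hxb.1
    have h3 := hxb.2 v hv.1
    have h4 : ‖v - xb‖ ^ 2 ≤ 0 := by
      by_contra! hcon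
      linarith [mul_pos hρ hcon]
    exact sub_eq_zero.1 (norm_eq_zero.1 (pow_eq_zero_iff two_ne_zero |>.1
      (le_antisymm h4 (sq_nonneg _))))
  set η : ℝ := (1 - 3 * α) / 2 with hη
  have hη0 : 0 < η := by linarith
  set E : ℕ → ℝ := fun n =>
    ‖x (n + 1) - xb‖ ^ 2 - α * ‖x n - xb‖ ^ 2 + (2 * α + η) * ‖x (n + 1) - x n‖ ^ 2 with hEdef
  have hElow (n : ℕ) : ‖x (n + 1) - xb‖ ^ 2 / 3 ≤ E n :=
    inertial_energy_lower_bound hα0 hα1 (by linarith) _ _ _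
  have hE0 (n : ℕ) : 0 ≤ E n := le_trans (by positivity) (hElow n)
  set l : ℕ → ℝ := fun n => lam (n + 1) with hl
  have hl0 (n : ℕ) : 0 < l n := hlam _
  have hllim : Tendsto l atTop (𝓝 0) := hlam0.comp (tendsto_add_atTop_nat 1)
  have hdiv : ¬ Summable l := fun h => hlamdiv ((summable_nat_add_iff 1).1 h)
  have hstep (n : ℕ) (y : H) (hy : y ∈ K) :
      0 ≤ beta (n + 1) * f (x (n + 2)) y + g (x (n + 2)) y + (1 / l n) *
        ⟪x (n + 2) - (x (n + 1) + α • (x (n + 1) - x n)), y - x (n + 2)⟫ := by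
    simpa using hxI (n + 1) (by omega) y hy
  have hdecr (n : ℕ) : E (n + 1) ≤ E n - η * ‖x (n + 1) - x n‖ ^ 2
      - η * ‖x (n + 2) - x (n + 1)‖ ^ 2
      + l n * (-2 * g xb (x (n + 2)) - 2 * ρ * ‖x (n + 2) - xb‖ ^ 2) := by
    have h1 := hstep n xb huK
    have h2 : f (x (n + 2)) xb ≤ 0 := by
      linarith [hfmono _ (hxK (n + 2)) xb huK, hxb.1.2 _ (hxK (n + 2))]
    have h3 := hgstrong _ (hxK (n + 2)) xb huK
    have h4 := inertial_inner_lower_bound hα0 (x (n + 2)) (x (n + 1)) (x n) xb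
    have h5 := mul_nonpos_of_nonneg_of_nonpos (hbeta (n + 1)).le h2
    rw [← neg_sub (x (n + 2)) xb, inner_neg_right] at h1
    set I := ⟪x (n + 2) - (x (n + 1) + α • (x (n + 1) - x n)), x (n + 2) - xb⟫
    have h6 : 1 / l n * I ≤ -g xb (x (n + 2)) - ρ * ‖x (n + 2) - xb‖ ^ 2 := by linarith
    have h7 : I ≤ l n * (-g xb (x (n + 2)) - ρ * ‖x (n + 2) - xb‖ ^ 2) := by
      have := mul_le_mul_of_nonneg_left h6 (hl0 n).le
      rwa [← mul_assoc, mul_one_div_cancel (hl0 n).ne', one_mul] at this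
    have h8 : η = 1 - 3 * α - η := by rw [hη]; ring
    have h9 : η * ‖x (n + 2) - x (n + 1)‖ ^ 2 = (1 - 3 * α - η) * ‖x (n + 2) - x (n + 1)‖ ^ 2 := by
      rw [← h8]
    simp only [hEdef, add_assoc, Nat.reduceAdd] at *
    linarith
  have hpl (n : ℕ) : -(‖p‖ * ‖x (n + 2) - xb‖) ≤ g xb (x (n + 2)) :=
    (neg_le_of_abs_le (abs_real_inner_le_norm _ _)).trans (hp _ (hxK _))
  -- consequences of a step without sufficient decrease
  have hsmall {κ : ℝ} {n : ℕ} (hn : E n - κ * l n ≤ E (n + 1)) :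
      ρ * ‖x (n + 2) - xb‖ ^ 2 ≤ κ + ‖p‖ ^ 2 / ρ ∧
      2 * ρ * ‖x (n + 2) - xb‖ ^ 2 ≤ κ - 2 * g xb (x (n + 2)) ∧
      η * (‖x (n + 1) - x n‖ ^ 2 + ‖x (n + 2) - x (n + 1)‖ ^ 2) ≤ l n * (κ + ‖p‖ ^ 2 / ρ) := by
    have hyoung : 2 * (‖p‖ * ‖x (n + 2) - xb‖) ≤ ρ * ‖x (n + 2) - xb‖ ^ 2 + ‖p‖ ^ 2 / ρ := by
      have h : ρ * ‖x (n + 2) - xb‖ ^ 2 + ‖p‖ ^ 2 / ρ - 2 * (‖p‖ * ‖x (n + 2) - xb‖)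
          = (ρ * ‖x (n + 2) - xb‖ - ‖p‖) ^ 2 / ρ := by
        field_simp
        ring
      linarith [div_nonneg (sq_nonneg (ρ * ‖x (n + 2) - xb‖ - ‖p‖)) hρ.le]
    have h1 := hdecr n
    have h2 : η * (‖x (n + 1) - x n‖ ^ 2 + ‖x (n + 2) - x (n + 1)‖ ^ 2) ≤
        l n * (κ - 2 * g xb (x (n + 2)) - 2 * ρ * ‖x (n + 2) - xb‖ ^ 2) := by linarith
    have h3 : 0 ≤ κ - 2 * g xb (x (n + 2)) - 2 * ρ * ‖x (n + 2) - xb‖ ^ 2 :=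
      nonneg_of_mul_nonneg_right (le_trans (by positivity) h2) (hl0 n)
    have h4 := hpl n
    refine ⟨by linarith, by linarith, h2.trans (mul_le_mul_of_nonneg_left ?_ (hl0 n).le)⟩
    have : 0 ≤ ρ * ‖x (n + 2) - xb‖ ^ 2 := by positivity
    linarith
  have hmain {κ : ℝ} (hκ : 0 < κ) : ∀ᶠ n in atTop, E n ≤ κ / ρ + κ := by
    refine eventually_le_of_insufficient_decrease hκ hE0 hl0 hdiv ?_
    set B : Set ℕ := {n | E n - κ * l n ≤ E (n + 1)} with hB
    set F : Filter ℕ := atTop ⊓ 𝓟 B with hF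
    have hFB : ∀ᶠ n in F, n ∈ B := (inf_le_right : F ≤ 𝓟 B) (mem_principal_self _)
    have hFtop : F ≤ atTop := inf_le_left
    have hD : Tendsto (fun n => ‖x (n + 1) - x n‖ ^ 2 + ‖x (n + 2) - x (n + 1)‖ ^ 2) F (𝓝 0) := by
      have hb : Tendsto (fun n => l n * (κ + ‖p‖ ^ 2 / ρ) / η) F (𝓝 0) := by
        simpa using ((hllim.mono_left hFtop).mul_const (κ + ‖p‖ ^ 2 / ρ)).div_const η
      refine tendsto_of_tendsto_of_tendsto_of_le_of_le' tendsto_const_nhds hb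
        (Eventually.of_forall fun n => by positivity) (hFB.mono fun n hn => ?_)
      rw [le_div_iff₀' hη0]
      exact (hsmall hn).2.2
    have hd1 : Tendsto (fun n => ‖x (n + 2) - x (n + 1)‖ ^ 2) F (𝓝 0) :=
      squeeze_zero (fun n => by positivity) (fun n => by linarith [sq_nonneg ‖x (n + 1) - x n‖]) hD
    have hd0 : Tendsto (fun n => ‖x (n + 1) - x n‖ ^ 2) F (𝓝 0) :=
      squeeze_zero (fun n => by positivity)
        (fun n => by linarith [sq_nonneg ‖x (n + 2) - x (n + 1)‖]) hD
    have hsqrt {u : ℕ → ℝ} (hu : ∀ n, 0 ≤ u n) (h : Tendsto (fun n => u n ^ 2) F (𝓝 0)) :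
        Tendsto u F (𝓝 0) := by
      simpa [Real.sqrt_sq (hu _)] using h.sqrt
    have hyn : Tendsto (fun n => ‖x (n + 2) - x (n + 1)‖ + α * ‖x (n + 1) - x n‖) F (𝓝 0) := by
      simpa using (hsqrt (fun n => norm_nonneg _) hd1).add
        ((hsqrt (fun n => norm_nonneg _) hd0).const_mul α)
    set A : ℝ := √((κ + ‖p‖ ^ 2 / ρ) / ρ) with hA
    have hbd : ∀ᶠ n in F, ‖x (n + 2) - xb‖ ≤ A := hFB.mono fun n hn => by
      refine Real.le_sqrt_of_sq_le ?_
      rw [le_div_iff₀' hρ]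
      exact (hsmall hn).1
    have hfy : ∀ y ∈ K, ∀ δ > 0, ∀ᶠ n in F, f y (x (n + 2)) ≤ δ := by
      intro y hy δ hδ
      obtain ⟨q, hq⟩ := hgsub y hy
      set R : ℝ := A + ‖xb - y‖ with hR
      have hbeta' : Tendsto (fun n => (beta (n + 1))⁻¹) F (𝓝 0) :=
        (hbetaTop.comp (tendsto_add_atTop_nat 1)).inv_tendsto_atTop.mono_left hFtop
      have hlim : Tendsto (fun n => (beta (n + 1))⁻¹ * (‖q‖ * R)
          + c⁻¹ * ((‖x (n + 2) - x (n + 1)‖ + α * ‖x (n + 1) - x n‖) * R)) F (𝓝 0) := by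
        simpa using (hbeta'.mul_const (‖q‖ * R)).add ((hyn.mul_const R).const_mul c⁻¹)
      have hcl' : ∀ᶠ n in F, c ≤ l n * beta (n + 1) :=
        ((tendsto_add_atTop_nat 1).eventually hcl).filter_mono hFtop
      filter_upwards [hlim.eventually (gt_mem_nhds hδ), hcl', hbd] with n hn hcn hAn
      refine le_trans ?_ hn.le
      have hb := hbeta (n + 1)
      have hyR : ‖x (n + 2) - y‖ ≤ R := by
        have := norm_sub_le_norm_sub_add_norm_sub (x (n + 2)) xb y
        linarith
      have hg : g (x (n + 2)) y ≤ ‖q‖ * R := by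
        have h1 := (neg_le_of_abs_le (abs_real_inner_le_norm q (x (n + 2) - y))).trans
          (hq _ (hxK (n + 2)))
        have h2 := mul_le_mul_of_nonneg_left hyR (norm_nonneg q)
        linarith [hgmono _ (hxK (n + 2)) y hy]
      have hI : ⟪x (n + 2) - (x (n + 1) + α • (x (n + 1) - x n)), y - x (n + 2)⟫ ≤
          (‖x (n + 2) - x (n + 1)‖ + α * ‖x (n + 1) - x n‖) * R := by
        refine (real_inner_le_norm _ _).trans ?_
        rw [norm_sub_rev y]
        refine mul_le_mul ?_ hyR (norm_nonneg _) (by positivity)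
        rw [← sub_sub]
        refine (norm_sub_le _ _).trans ?_
        rw [norm_smul, Real.norm_of_nonneg hα0]
      set J := (‖x (n + 2) - x (n + 1)‖ + α * ‖x (n + 1) - x n‖) * R
      have hJ : 0 ≤ J := mul_nonneg (by positivity) ((norm_nonneg _).trans hyR)
      have h1 : 0 ≤ beta (n + 1) * f (x (n + 2)) y + ‖q‖ * R + 1 / l n * J := by
        have := mul_le_mul_of_nonneg_left hI (one_div_pos.2 (hl0 n)).le
        linarith [hstep n y hy]
      have h2 : -f (x (n + 2)) y ≤ (beta (n + 1))⁻¹ * (‖q‖ * R) + (l n * beta (n + 1))⁻¹ * J := by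
        have h := mul_nonneg (inv_pos.2 hb).le h1
        have e : (beta (n + 1))⁻¹ * (beta (n + 1) * f (x (n + 2)) y + ‖q‖ * R + 1 / l n * J) =
            f (x (n + 2)) y + (beta (n + 1))⁻¹ * (‖q‖ * R) + (l n * beta (n + 1))⁻¹ * J := by
          have := (hl0 n).ne'
          field_simp
        linarith
      have h3 : (l n * beta (n + 1))⁻¹ * J ≤ c⁻¹ * J :=
        mul_le_mul_of_nonneg_right (inv_anti₀ hc hcn) hJ
      linarith [hfmono _ (hxK (n + 2)) y hy]
    have hgl : ∀ᶠ n in F, -(κ / 2) < g xb (x (n + 2)) := by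
      refine eventually_neg_lt_of_mem_Sol hKcl hKcv hfUHC hfEq hgEq hxb (fun n => hxK (n + 2))
        (R := A + ‖xb‖) (hbd.mono fun n hn => ?_) hfy (by positivity)
      have := norm_sub_le_norm_sub_add_norm_sub (x (n + 2)) xb 0
      simp only [sub_zero] at this
      linarith
    have hfin : ∀ᶠ n in F, E (n + 1) ≤ κ / ρ + κ := by
      filter_upwards [hFB, hgl, hd1.eventually (gt_mem_nhds hκ)] with n hn hgn hdn
      have h1 : ‖x (n + 2) - xb‖ ^ 2 ≤ κ / ρ := by
        rw [le_div_iff₀' hρ]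
        linarith [(hsmall hn).2.1]
      have h2 : E (n + 1) = ‖x (n + 2) - xb‖ ^ 2 - α * ‖x (n + 1) - xb‖ ^ 2
          + (2 * α + η) * ‖x (n + 2) - x (n + 1)‖ ^ 2 := rfl
      have h3 : (2 * α + η) * ‖x (n + 2) - x (n + 1)‖ ^ 2 ≤ 1 * ‖x (n + 2) - x (n + 1)‖ ^ 2 :=
        mul_le_mul_of_nonneg_right (by linarith) (sq_nonneg _)
      have h4 := mul_nonneg hα0 (sq_nonneg ‖x (n + 1) - xb‖)
      linarith
    exact eventually_inf_principal.1 hfin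
  have hElim : Tendsto E atTop (𝓝 0) := by
    refine tendsto_order.2 ⟨fun a ha => Eventually.of_forall fun n => ha.trans_le (hE0 n),
      fun a ha => ?_⟩
    have hs : 0 < 1 / ρ + 1 := by positivity
    filter_upwards [hmain (div_pos (half_pos ha) hs)] with n hn
    have e : a / 2 / (1 / ρ + 1) / ρ + a / 2 / (1 / ρ + 1) = a / 2 := by
      field_simp
    linarith
  have hsq : Tendsto (fun n => ‖x (n + 1) - xb‖ ^ 2) atTop (𝓝 0) :=
    squeeze_zero (g := fun n => 3 * E n) (fun n => by positivity)
      (fun n => by linarith [hElow n]) (by simpa using hElim.const_mul 3)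
  refine (tendsto_add_atTop_iff_nat 1).1 ?_
  simpa using hsq.sqrt
end
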